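/- arXiv:math/0108040 — 2 statements merged into one kernel-verified Lean document; each statement's English description precedes it below -/
import Mathlib

section
/- Let π: P → H be a surjective map of Hopf algebras over a field k, B := Pᴴ, and let Y be a left P-module, left P-comodule, right H-comodule and right B-module with all structures pairwise compatible. Then the map Y → P ⊗ ᴾY, y ↦ y₍₋₁₎ ⊗ S(y₍₀₎₍₋₁₎)▷y₍₀₎₍₀₎ (i.e. y ↦ y₁ ⊗ S(y₂)▷y₃ using the iterated coaction), is a bijection with inverse p⊗y ↦ p▷y, where ᴾY := {y ∈ Y : y₍₋₁₎⊗y₍₀₎ = 1⊗y}; moreover it is an isomorphism with respect to all four (co)module structures when P⊗ᴾY carries the regular left structures on P and the tensor product right structures. -/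
open TensorProduct CategoryTheory

noncomputable section

/- STATEMENT 11: for a (P,P,H,B)-Hopf module Y, the map
y ↦ y₍₋₁₎ ⊗ S(y₍₀₎₍₋₁₎)▷y₍₀₎₍₀₎ is a bijection Y ≅ P ⊗ ᴾY with inverse p⊗y ↦ p▷y,
an isomorphism for all four (co)module structures. -/

section Props
variable {k : Type} [Field k] {H : Type} [Ring H] [HopfAlgebra k H]
variable {A : Type} [Ring A] [Algebra k A]
variable {V : Type} [AddCommGroup V] [Module k V]

/-- `ρ : V → V ⊗ H` is a right `H`-comodule structure. -/
def IsRightCoaction (ρ : V →ₗ[k] V ⊗[k] H) : Prop :=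
  (∀ v, (TensorProduct.rid k V)
      ((LinearMap.lTensor V (Coalgebra.counit (R := k) (A := H))) (ρ v)) = v) ∧
  (∀ v, (LinearMap.rTensor H ρ) (ρ v) =
    (TensorProduct.assoc k V H H).symm
      ((LinearMap.lTensor V (Coalgebra.comul (R := k) (A := H))) (ρ v)))

/-- `lam : V → H ⊗ V` is a left `H`-comodule structure. -/
def IsLeftCoaction (lam : V →ₗ[k] H ⊗[k] V) : Prop :=
  (∀ v, (TensorProduct.lid k V)
      ((LinearMap.rTensor V (Coalgebra.counit (R := k) (A := H))) (lam v)) = v) ∧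
  (∀ v, (LinearMap.lTensor H lam) (lam v) =
    (TensorProduct.assoc k H H V)
      ((LinearMap.rTensor V (Coalgebra.comul (R := k) (A := H))) (lam v)))

/-- `act : V ⊗ A → V` is a right `A`-module structure on the `k`-vector space `V`. -/
def IsRightAction (act : V ⊗[k] A →ₗ[k] V) : Prop :=
  (∀ v, act (v ⊗ₜ (1 : A)) = v) ∧
  (∀ (v : V) (a b : A), act (v ⊗ₜ (a * b)) = act (act (v ⊗ₜ a) ⊗ₜ b))

/-- `act : A ⊗ V → V` is a left `A`-module structure on the `k`-vector space `V`. -/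
def IsLeftAction (act : A ⊗[k] V →ₗ[k] V) : Prop :=
  (∀ v, act ((1 : A) ⊗ₜ v) = v) ∧
  (∀ (a b : A) (v : V), act ((a * b) ⊗ₜ v) = act (a ⊗ₜ act (b ⊗ₜ v)))

end Props

variable {k : Type} [Field k]
variable {P : Type} [Ring P] [HopfAlgebra k P]
variable {H : Type} [Ring H] [HopfAlgebra k H]

/-- The quantum homogeneous space `B = Pᴴ = {p : p₁ ⊗ π(p₂) = p ⊗ 1}`,
as a `k`-subspace of `P`. -/
def qhs (π : P →ₐc[k] H) : Submodule k P :=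
  LinearMap.ker ((LinearMap.lTensor P (π : P →ₗ[k] H)) ∘ₗ
    (Coalgebra.comul (R := k) (A := P)) - (TensorProduct.mk k P H).flip 1)

lemma mem_qhs (π : P →ₐc[k] H) (p : P) :
    p ∈ qhs π ↔ (LinearMap.lTensor P (π : P →ₗ[k] H))
      (Coalgebra.comul (R := k) (A := P) p) = p ⊗ₜ (1 : H) := by
  simp [qhs, sub_eq_zero, LinearMap.mem_ker]

lemma lTensor_pi_eq (π : P →ₐc[k] H) :
    (LinearMap.lTensor P (π : P →ₗ[k] H)) =
      (Algebra.TensorProduct.map (AlgHom.id k P) (π : P →ₐ[k] H)).toLinearMap :=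
  TensorProduct.ext' fun p q => by
    simp [Algebra.TensorProduct.map_tmul]

/-- The quantum homogeneous space `B = Pᴴ` as a subalgebra of `P`. -/
def qhsAlg (π : P →ₐc[k] H) : Subalgebra k P where
  carrier := qhs π
  add_mem' ha hb := (qhs π).add_mem ha hb
  zero_mem' := (qhs π).zero_mem
  one_mem' := by
    rw [SetLike.mem_coe, mem_qhs, Bialgebra.comul_one, Algebra.TensorProduct.one_def]
    simp
  mul_mem' := by
    intro a b ha hb
    rw [SetLike.mem_coe, mem_qhs] at ha hb ⊢
    rw [lTensor_pi_eq] at ha hb ⊢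
    simp only [AlgHom.toLinearMap_apply] at ha hb ⊢
    have hc := map_mul (Bialgebra.comulAlgHom k P) a b
    simp only [Bialgebra.comulAlgHom_apply] at hc
    rw [hc, map_mul, ha, hb, Algebra.TensorProduct.tmul_mul_tmul, one_mul]
  algebraMap_mem' := by
    intro r
    rw [Algebra.algebraMap_eq_smul_one]
    exact (qhs π).smul_mem r (by
      rw [mem_qhs, Bialgebra.comul_one, Algebra.TensorProduct.one_def]
      simp)

/-- The inclusion `B → P` as a `k`-linear map. -/
def qhsIncl (π : P →ₐc[k] H) : (qhsAlg π) →ₗ[k] P := (qhsAlg π).val.toLinearMap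

/-- `coactB : B → P ⊗ B` is the restriction of the comultiplication of `P`
(such a map exists and is unique since `Δ(B) ⊆ P ⊗ B`). -/
def IsRestrictedComul (π : P →ₐc[k] H)
    (coactB : (qhsAlg π) →ₗ[k] P ⊗[k] (qhsAlg π)) : Prop :=
  (LinearMap.lTensor P (qhsIncl π)) ∘ₗ coactB =
    (Coalgebra.comul (R := k) (A := P)) ∘ₗ (qhsIncl π)

/-- The right `H`-coaction `p ↦ p₁ ⊗ π(p₂)` on `P`. -/
def piCoact (π : P →ₐc[k] H) : P →ₗ[k] P ⊗[k] H :=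
  (LinearMap.lTensor P (π : P →ₗ[k] H)) ∘ₗ (Coalgebra.comul (R := k) (A := P))

/-- The map `a ↦ a₂ ⊗ π(S(a₁))` on `P`. -/
def adCoact₀ (π : P →ₐc[k] H) : P →ₗ[k] P ⊗[k] H :=
  (LinearMap.lTensor P ((π : P →ₗ[k] H) ∘ₗ (HopfAlgebra.antipode (R := k) (A := P)))) ∘ₗ
    (TensorProduct.comm k P P).toLinearMap ∘ₗ
    (Coalgebra.comul (R := k) (A := P))

/-- The crossed `(H,B)`-module condition
`x₍₀₎ ◁ b ⊗ x₍₁₎ = (x ◁ b₂)₍₀₎ ⊗ π(b₁)(x ◁ b₂)₍₁₎` for a right `B`-module and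
right `H`-comodule `X`, where `Δ(b) = b₁ ⊗ b₂ ∈ P ⊗ B` is given by `coactB`. -/
def IsCrossedPair (π : P →ₐc[k] H)
    (coactB : (qhsAlg π) →ₗ[k] P ⊗[k] (qhsAlg π))
    {X : Type} [AddCommGroup X] [Module k X]
    (ract : X ⊗[k] (qhsAlg π) →ₗ[k] X) (ρ : X →ₗ[k] X ⊗[k] H) : Prop :=
  (LinearMap.rTensor H ract) ∘ₗ
      (TensorProduct.assoc k X (qhsAlg π) H).symm.toLinearMap ∘ₗ
      (LinearMap.lTensor X (TensorProduct.comm k H (qhsAlg π)).toLinearMap) ∘ₗ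
      (TensorProduct.assoc k X H (qhsAlg π)).toLinearMap ∘ₗ
      (LinearMap.rTensor (qhsAlg π) ρ) =
  (LinearMap.lTensor X (LinearMap.mul' k H)) ∘ₗ
      (TensorProduct.leftComm k H X H).toLinearMap ∘ₗ
      (TensorProduct.map (π : P →ₗ[k] H) (ρ ∘ₗ ract)) ∘ₗ
      (TensorProduct.leftComm k X P (qhsAlg π)).toLinearMap ∘ₗ
      (LinearMap.lTensor X coactB)

/-- A left `P`-module, left `P`-comodule, right `H`-comodule, right `B`-module
with all structures pairwise compatible, on a fixed `k`-vector space `Y`.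
Here `coactB` is the restricted comultiplication `B → P ⊗ B`. -/
structure PPHBStr (π : P →ₐc[k] H)
    (coactB : (qhsAlg π) →ₗ[k] P ⊗[k] (qhsAlg π))
    (Y : Type) [AddCommGroup Y] [Module k Y] where
  lact : P ⊗[k] Y →ₗ[k] Y
  ract : Y ⊗[k] (qhsAlg π) →ₗ[k] Y
  lam : Y →ₗ[k] P ⊗[k] Y
  ρ : Y →ₗ[k] Y ⊗[k] H
  lact_action : IsLeftAction lact
  ract_action : IsRightAction ract
  lam_coaction : IsLeftCoaction lam
  ρ_coaction : IsRightCoaction ρ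
  acts_comm : ∀ (p : P) (y : Y) (b : qhsAlg π),
    ract (lact (p ⊗ₜ y) ⊗ₜ b) = lact (p ⊗ₜ ract (y ⊗ₜ b))
  coacts_comm : ∀ y, (LinearMap.rTensor H lam) (ρ y) =
    (TensorProduct.assoc k P Y H).symm ((LinearMap.lTensor P ρ) (lam y))
  /-- `λ(p ▷ y) = p₁ y₍₋₁₎ ⊗ p₂ ▷ y₍₀₎` -/
  lact_lam : lam ∘ₗ lact =
    (TensorProduct.map (LinearMap.mul' k P) lact) ∘ₗ
      (tensorTensorTensorComm k P P P Y).toLinearMap ∘ₗ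
      (TensorProduct.map (Coalgebra.comul (R := k) (A := P)) lam)
  /-- `ρ(p ▷ y) = p₁ ▷ y₍₀₎ ⊗ π(p₂) y₍₁₎` -/
  lact_ρ : ρ ∘ₗ lact =
    (TensorProduct.map lact (LinearMap.mul' k H)) ∘ₗ
      (tensorTensorTensorComm k P H Y H).toLinearMap ∘ₗ
      (TensorProduct.map (piCoact π) ρ)
  /-- `λ(y ◁ b) = y₍₋₁₎ b₁ ⊗ y₍₀₎ ◁ b₂` -/
  ract_lam : lam ∘ₗ ract =
    (TensorProduct.map (LinearMap.mul' k P) ract) ∘ₗ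
      (tensorTensorTensorComm k P Y P (qhsAlg π)).toLinearMap ∘ₗ
      (TensorProduct.map lam coactB)
  /-- `ρ(y ◁ b) = y₍₀₎ ◁ b ⊗ y₍₁₎` (`B` carries the trivial `H`-coaction) -/
  ract_ρ : ρ ∘ₗ ract =
    (LinearMap.rTensor H ract) ∘ₗ
      (TensorProduct.assoc k Y (qhsAlg π) H).symm.toLinearMap ∘ₗ
      (LinearMap.lTensor Y (TensorProduct.comm k H (qhsAlg π)).toLinearMap) ∘ₗ
      (TensorProduct.assoc k Y H (qhsAlg π)).toLinearMap ∘ₗ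
      (LinearMap.rTensor (qhsAlg π) ρ)

/-- The coinvariants `ᴾY = {y : y₍₋₁₎ ⊗ y₍₀₎ = 1 ⊗ y}` of a left `P`-coaction. -/
def leftCoinv {Y : Type} [AddCommGroup Y] [Module k Y]
    (lam : Y →ₗ[k] P ⊗[k] Y) : Submodule k Y :=
  LinearMap.ker (lam - (TensorProduct.mk k P Y) 1)

/-- The twisted right `B`-action `y ⋄ b = S(b₁) ▷ y ◁ b₂` on a left `P`-module
right `B`-module `Y` (where `Δ(b) = b₁ ⊗ b₂ ∈ P ⊗ B` is given by `coactB`). -/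
def twistRact (π : P →ₐc[k] H) (coactB : (qhsAlg π) →ₗ[k] P ⊗[k] (qhsAlg π))
    {Y : Type} [AddCommGroup Y] [Module k Y]
    (lact : P ⊗[k] Y →ₗ[k] Y) (ract : Y ⊗[k] (qhsAlg π) →ₗ[k] Y) :
    Y ⊗[k] (qhsAlg π) →ₗ[k] Y :=
  lact ∘ₗ
    (TensorProduct.map (HopfAlgebra.antipode (R := k) (A := P)) ract) ∘ₗ
    (TensorProduct.leftComm k Y P (qhsAlg π)).toLinearMap ∘ₗ
    (LinearMap.lTensor Y coactB)

variable {π : P →ₐc[k] H} {coactB : (qhsAlg π) →ₗ[k] P ⊗[k] (qhsAlg π)}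
variable {Y : Type} [AddCommGroup Y] [Module k Y]

/-- The map `Θ : P ⊗ ᴾY → Y`, `p ⊗ y ↦ p ▷ y`. -/
def thetaMap (D : PPHBStr π coactB Y) :
    P ⊗[k] (leftCoinv D.lam) →ₗ[k] Y :=
  D.lact ∘ₗ LinearMap.lTensor P (leftCoinv D.lam).subtype

/-- The map `Ψ : Y → P ⊗ Y`, `y ↦ y₍₋₁₎ ⊗ S(y₍₀₎₍₋₁₎) ▷ y₍₀₎₍₀₎`. -/
def psiMap (D : PPHBStr π coactB Y) : Y →ₗ[k] P ⊗[k] Y :=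
  (LinearMap.lTensor P
      (D.lact ∘ₗ (LinearMap.rTensor Y (HopfAlgebra.antipode (R := k) (A := P))))) ∘ₗ
    (LinearMap.lTensor P D.lam) ∘ₗ D.lam

section Convolution

variable {C V : Type} [AddCommGroup C] [Module k C] [AddCommGroup V] [Module k V]

/-- The map `c ↦ f(c₍₋₁₎) ▷ g(c₍₀₎)`. -/
def coactConv (act : P ⊗[k] V →ₗ[k] V) (lam : C →ₗ[k] P ⊗[k] C) (f : P →ₗ[k] P)
    (g : C →ₗ[k] V) : C →ₗ[k] V :=
  act ∘ₗ TensorProduct.map f g ∘ₗ lam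

lemma coactConv_coactConv {act : P ⊗[k] V →ₗ[k] V} {lam : C →ₗ[k] P ⊗[k] C}
    (hact : IsLeftAction act) (hlam : IsLeftCoaction lam) (f f' : P →ₗ[k] P) (g : C →ₗ[k] V) :
    coactConv act lam f (coactConv act lam f' g) =
      coactConv act lam (LinearMap.mul' k P ∘ₗ TensorProduct.map f f' ∘ₗ
        Coalgebra.comul (R := k) (A := P)) g := by
  have h : ∀ z : P ⊗[k] (P ⊗[k] C),
      act (TensorProduct.map f (act ∘ₗ TensorProduct.map f' g) z) =
        act (TensorProduct.map (LinearMap.mul' k P ∘ₗ TensorProduct.map f f') g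
          ((TensorProduct.assoc k P P C).symm z)) := by
    intro z
    induction z with
    | zero => simp
    | add x y hx hy => simp only [map_add, hx, hy]
    | tmul p z =>
      induction z with
      | zero => simp
      | add x y hx hy => simp only [TensorProduct.tmul_add, map_add, hx, hy]
      | tmul q c => simp [hact.2]
  ext c
  have h1 := h (LinearMap.lTensor P lam (lam c))
  rw [hlam.2 c] at h1
  rw [LinearEquiv.symm_apply_apply, ← hlam.2 c] at h1
  simp only [coactConv, LinearMap.comp_apply]
  calc _ = _ := ?_
    _ = _ := h1
    _ = _ := ?_
  · rw [← LinearMap.comp_apply (TensorProduct.map f (act ∘ₗ TensorProduct.map f' g)),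
      LinearMap.map_comp_lTensor]
    rfl
  · rw [← LinearMap.comp_apply (TensorProduct.map _ g), LinearMap.map_comp_rTensor]
    rfl

lemma coactConv_counit {act : P ⊗[k] V →ₗ[k] V} {lam : C →ₗ[k] P ⊗[k] C}
    (hact : IsLeftAction act) (hlam : IsLeftCoaction lam) (g : C →ₗ[k] V) :
    coactConv act lam (Algebra.linearMap k P ∘ₗ Coalgebra.counit) g = g := by
  have h : ∀ z : P ⊗[k] C,
      act (TensorProduct.map (Algebra.linearMap k P ∘ₗ Coalgebra.counit) g z) =
        g (TensorProduct.lid k C (LinearMap.rTensor C Coalgebra.counit z)) := by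
    intro z
    induction z with
    | zero => simp
    | add x y hx hy => simp only [map_add, hx, hy]
    | tmul p c =>
      simp [Algebra.algebraMap_eq_smul_one, ← TensorProduct.smul_tmul', hact.1]
  ext c
  simp only [coactConv, LinearMap.comp_apply]
  rw [h, hlam.1]

lemma coactConv_antipode_id {act : P ⊗[k] V →ₗ[k] V} {lam : C →ₗ[k] P ⊗[k] C}
    (hact : IsLeftAction act) (hlam : IsLeftCoaction lam) (g : C →ₗ[k] V) :
    coactConv act lam (HopfAlgebra.antipode k) (coactConv act lam LinearMap.id g) = g := by
  rw [coactConv_coactConv hact hlam]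
  refine Eq.trans ?_ (coactConv_counit hact hlam g)
  congr 1
  exact HopfAlgebra.mul_antipode_rTensor_comul

lemma coactConv_id_antipode {act : P ⊗[k] V →ₗ[k] V} {lam : C →ₗ[k] P ⊗[k] C}
    (hact : IsLeftAction act) (hlam : IsLeftCoaction lam) (g : C →ₗ[k] V) :
    coactConv act lam LinearMap.id (coactConv act lam (HopfAlgebra.antipode k) g) = g := by
  rw [coactConv_coactConv hact hlam]
  refine Eq.trans ?_ (coactConv_counit hact hlam g)
  congr 1
  exact HopfAlgebra.mul_antipode_lTensor_comul

end Convolution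

lemma isLeftCoaction_comul : IsLeftCoaction (Coalgebra.comul (R := k) (A := P)) := by
  refine ⟨fun v => ?_, fun v => ?_⟩
  · rw [Coalgebra.rTensor_counit_comul]; simp
  · exact (Coalgebra.coassoc_apply v).symm

lemma isLeftCoaction_of_isRestrictedComul (hco : IsRestrictedComul π coactB) :
    IsLeftCoaction coactB := by
  have hinj : Function.Injective (qhsIncl π) := Subtype.val_injective
  have hco' : ∀ b, LinearMap.lTensor P (qhsIncl π) (coactB b) =
      Coalgebra.comul (R := k) (qhsIncl π b) := fun b => LinearMap.congr_fun hco b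
  refine ⟨fun b => hinj ?_, fun b => ?_⟩
  · have h : ∀ z : P ⊗[k] (qhsAlg π),
        qhsIncl π (TensorProduct.lid k _ (LinearMap.rTensor _ Coalgebra.counit z)) =
          TensorProduct.lid k P (LinearMap.rTensor P Coalgebra.counit
            (LinearMap.lTensor P (qhsIncl π) z)) := by
      intro z
      induction z with
      | zero => simp
      | add x y hx hy => simp only [map_add, hx, hy]
      | tmul p c => simp
    rw [h, hco', isLeftCoaction_comul.1]
  · have hinj2 : Function.Injective
        (LinearMap.lTensor P (LinearMap.lTensor P (qhsIncl π))) :=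
      Module.Flat.lTensor_preserves_injective_linearMap _
        (Module.Flat.lTensor_preserves_injective_linearMap _ hinj)
    apply hinj2
    have h : ∀ z : P ⊗[k] (qhsAlg π),
        LinearMap.lTensor P (LinearMap.lTensor P (qhsIncl π))
          (TensorProduct.assoc k P P _ (LinearMap.rTensor _ Coalgebra.comul z)) =
        TensorProduct.assoc k P P P (LinearMap.rTensor P Coalgebra.comul
          (LinearMap.lTensor P (qhsIncl π) z)) := by
      intro z
      induction z with
      | zero => simp
      | add x y hx hy => simp only [map_add, hx, hy]
      | tmul p c =>
        simp only [LinearMap.rTensor_tmul, LinearMap.lTensor_tmul]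
        generalize Coalgebra.comul (R := k) p = u
        induction u with
        | zero => simp
        | add x y hx hy => simp only [TensorProduct.add_tmul, map_add, hx, hy]
        | tmul p q => simp
    rw [h, hco', ← isLeftCoaction_comul.2, ← hco', ← LinearMap.comp_apply,
      ← LinearMap.lTensor_comp, hco, LinearMap.lTensor_comp]
    rfl

section Diagonal

variable {V : Type} [AddCommGroup V] [Module k V]

/-- The diagonal action `p ▷ (q ⊗ v) = p₁ q ⊗ p₂ ▷ v` on `P ⊗ V`. -/
def diagAct (act : P ⊗[k] V →ₗ[k] V) : P ⊗[k] (P ⊗[k] V) →ₗ[k] P ⊗[k] V :=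
  (TensorProduct.map (LinearMap.mul' k P) act) ∘ₗ
    (tensorTensorTensorComm k P P P V).toLinearMap ∘ₗ
    (LinearMap.rTensor (P ⊗[k] V) (Coalgebra.comul (R := k) (A := P)))

lemma isLeftAction_diagAct {act : P ⊗[k] V →ₗ[k] V} (hact : IsLeftAction act) :
    IsLeftAction (diagAct act) := by
  refine ⟨fun z => ?_, fun a b z => ?_⟩
  · induction z with
    | zero => simp
    | add x y hx hy => simp only [TensorProduct.tmul_add, map_add, hx, hy]
    | tmul p v => simp [diagAct, Algebra.TensorProduct.one_def, hact.1]
  · simp only [diagAct, LinearMap.comp_apply, LinearMap.rTensor_tmul, Bialgebra.comul_mul]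
    generalize Coalgebra.comul (R := k) a = u
    generalize Coalgebra.comul (R := k) b = w
    induction z with
    | zero => simp
    | add x y hx hy => simp only [TensorProduct.tmul_add, map_add, hx, hy]
    | tmul p v =>
      induction w with
      | zero => simp
      | add x y hx hy =>
        simp only [mul_add, TensorProduct.tmul_add, TensorProduct.add_tmul, map_add, hx, hy]
      | tmul w w' =>
        induction u with
        | zero => simp
        | add x y hx hy => simp only [add_mul, TensorProduct.add_tmul, map_add, hx, hy]
        | tmul u u' => simp [hact.2, mul_assoc]

lemma diagAct_one_tmul (act : P ⊗[k] V →ₗ[k] V) (p : P) (v : V) :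
    diagAct act (p ⊗ₜ ((1 : P) ⊗ₜ v)) =
      LinearMap.lTensor P (act ∘ₗ (TensorProduct.mk k P V).flip v)
        (Coalgebra.comul (R := k) p) := by
  simp only [diagAct, LinearMap.comp_apply, LinearMap.rTensor_tmul]
  generalize Coalgebra.comul (R := k) p = u
  induction u with
  | zero => simp
  | add x y hx hy => simp only [TensorProduct.add_tmul, map_add, hx, hy]
  | tmul u u' => simp

end Diagonal

lemma mem_leftCoinv {lam : Y →ₗ[k] P ⊗[k] Y} {y : Y} :
    y ∈ leftCoinv lam ↔ lam y = (1 : P) ⊗ₜ y := by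
  simp [leftCoinv, sub_eq_zero]

namespace PPHBStr

variable (D : PPHBStr π coactB Y)

lemma lam_lact_eq_diagAct (p : P) (y : Y) :
    D.lam (D.lact (p ⊗ₜ y)) = diagAct D.lact (p ⊗ₜ D.lam y) :=
  LinearMap.congr_fun D.lact_lam (p ⊗ₜ y)

/-- The projection `y ↦ S(y₍₋₁₎) ▷ y₍₀₎` of `Y` onto its coinvariants. -/
def coinvProj : Y →ₗ[k] Y :=
  coactConv D.lact D.lam (HopfAlgebra.antipode k) LinearMap.id

lemma lam_eq_coactConv_diagAct :
    coactConv (diagAct D.lact) D.lam LinearMap.id (TensorProduct.mk k P Y 1 ∘ₗ D.coinvProj) =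
      D.lam := by
  have h : ∀ z : P ⊗[k] Y,
      diagAct D.lact (TensorProduct.map LinearMap.id (TensorProduct.mk k P Y 1 ∘ₗ D.coinvProj) z) =
        LinearMap.lTensor P (D.lact ∘ₗ TensorProduct.map LinearMap.id D.coinvProj)
          (TensorProduct.assoc k P P Y (LinearMap.rTensor Y Coalgebra.comul z)) := by
    intro z
    induction z with
    | zero => simp
    | add x y hx hy => simp only [map_add, hx, hy]
    | tmul p y =>
      simp only [TensorProduct.map_tmul, LinearMap.id_apply, LinearMap.comp_apply,
        TensorProduct.mk_apply, diagAct_one_tmul, LinearMap.rTensor_tmul]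
      generalize Coalgebra.comul (R := k) p = u
      induction u with
      | zero => simp
      | add x y hx hy => simp only [TensorProduct.add_tmul, map_add, hx, hy]
      | tmul u u' => simp
  ext y
  simp only [coactConv, LinearMap.comp_apply]
  rw [h, ← D.lam_coaction.2, ← LinearMap.comp_apply, ← LinearMap.lTensor_comp]
  have h2 : (D.lact ∘ₗ TensorProduct.map LinearMap.id D.coinvProj) ∘ₗ D.lam = LinearMap.id :=
    coactConv_id_antipode D.lact_action D.lam_coaction LinearMap.id
  rw [h2, LinearMap.lTensor_id, LinearMap.id_apply]

lemma coinvProj_mem (y : Y) : D.coinvProj y ∈ leftCoinv D.lam := by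
  rw [mem_leftCoinv]
  have h1 : D.lam ∘ₗ D.coinvProj =
      coactConv (diagAct D.lact) D.lam (HopfAlgebra.antipode k) D.lam := by
    simp only [coinvProj, coactConv, ← LinearMap.comp_assoc]
    congr 1
    ext p y
    simp [lam_lact_eq_diagAct]
  have h2 := coactConv_antipode_id (isLeftAction_diagAct D.lact_action) D.lam_coaction
    (TensorProduct.mk k P Y 1 ∘ₗ D.coinvProj)
  rw [lam_eq_coactConv_diagAct, ← h1] at h2
  exact LinearMap.congr_fun h2 y

/-- The projection `y ↦ S(y₍₋₁₎) ▷ y₍₀₎` with values in the coinvariants. -/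
def toCoinv : Y →ₗ[k] leftCoinv D.lam :=
  D.coinvProj.codRestrict _ D.coinvProj_mem

lemma subtype_comp_toCoinv : (leftCoinv D.lam).subtype ∘ₗ D.toCoinv = D.coinvProj := rfl

lemma psiMap_eq : psiMap D = LinearMap.lTensor P D.coinvProj ∘ₗ D.lam := by
  rw [psiMap, ← LinearMap.comp_assoc, ← LinearMap.lTensor_comp]
  rfl

lemma psiMap_apply (y : Y) : psiMap D y = LinearMap.lTensor P (leftCoinv D.lam).subtype
    (LinearMap.lTensor P D.toCoinv (D.lam y)) := by
  rw [← LinearMap.comp_apply, ← LinearMap.lTensor_comp, subtype_comp_toCoinv, psiMap_eq]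
  rfl

lemma lam_lact_coinv (p : P) (c : leftCoinv D.lam) :
    D.lam (D.lact (p ⊗ₜ (c : Y))) =
      LinearMap.lTensor P (D.lact ∘ₗ (TensorProduct.mk k P Y).flip (c : Y))
        (Coalgebra.comul (R := k) p) := by
  rw [lam_lact_eq_diagAct, mem_leftCoinv.1 c.2, diagAct_one_tmul]

lemma coinvProj_lact_coinv (p : P) (c : leftCoinv D.lam) :
    D.coinvProj (D.lact (p ⊗ₜ (c : Y))) = Coalgebra.counit (R := k) p • (c : Y) := by
  have h := LinearMap.congr_fun (HopfAlgebra.mul_antipode_rTensor_comul (R := k) (A := P)) p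
  have h2 : ∀ u : P ⊗[k] P,
      D.lact (TensorProduct.map (HopfAlgebra.antipode k) LinearMap.id
        (LinearMap.lTensor P (D.lact ∘ₗ (TensorProduct.mk k P Y).flip (c : Y)) u)) =
      D.lact (LinearMap.mul' k P (LinearMap.rTensor P (HopfAlgebra.antipode k) u) ⊗ₜ (c : Y)) := by
    intro u
    induction u with
    | zero => simp
    | add x y hx hy => simp only [TensorProduct.add_tmul, map_add, hx, hy]
    | tmul u u' => simp [D.lact_action.2]
  simp only [LinearMap.comp_apply] at h
  simp only [coinvProj, coactConv, LinearMap.comp_apply]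
  rw [lam_lact_coinv, h2, h]
  simp [Algebra.algebraMap_eq_smul_one, ← TensorProduct.smul_tmul', D.lact_action.1]

lemma thetaMap_tmul (p : P) (c : leftCoinv D.lam) :
    thetaMap D (p ⊗ₜ c) = D.lact (p ⊗ₜ (c : Y)) := rfl

lemma psiMap_thetaMap (z : P ⊗[k] (leftCoinv D.lam)) :
    psiMap D (thetaMap D z) = LinearMap.lTensor P (leftCoinv D.lam).subtype z := by
  induction z with
  | zero => simp
  | add x y hx hy => simp only [map_add, hx, hy]
  | tmul p c =>
    rw [psiMap_eq, thetaMap_tmul, LinearMap.comp_apply, lam_lact_coinv, ← LinearMap.comp_apply,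
      ← LinearMap.lTensor_comp]
    have h : D.coinvProj ∘ₗ D.lact ∘ₗ (TensorProduct.mk k P Y).flip (c : Y) =
        (LinearMap.toSpanSingleton k Y (c : Y)) ∘ₗ Coalgebra.counit := by
      ext q
      simp [coinvProj_lact_coinv]
    rw [h, LinearMap.lTensor_comp, LinearMap.comp_apply, Coalgebra.lTensor_counit_comul]
    simp

lemma thetaMap_lTensor_toCoinv (y : Y) :
    thetaMap D (LinearMap.lTensor P D.toCoinv (D.lam y)) = y := by
  rw [thetaMap, LinearMap.comp_apply, ← LinearMap.comp_apply (LinearMap.lTensor P _),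
    ← LinearMap.lTensor_comp, subtype_comp_toCoinv]
  exact LinearMap.congr_fun
    (coactConv_id_antipode D.lact_action D.lam_coaction LinearMap.id) y

lemma thetaMap_bijective : Function.Bijective (thetaMap D) := by
  refine ⟨fun z w h => ?_, fun y => ⟨_, D.thetaMap_lTensor_toCoinv y⟩⟩
  refine Module.Flat.lTensor_preserves_injective_linearMap (M := P) (leftCoinv D.lam).subtype
    (leftCoinv D.lam).subtype_injective ?_
  rw [← psiMap_thetaMap, ← psiMap_thetaMap, h]

lemma thetaMap_mul :
    thetaMap D ∘ₗ (LinearMap.rTensor (leftCoinv D.lam) (LinearMap.mul' k P)) ∘ₗ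
        (TensorProduct.assoc k P P (leftCoinv D.lam)).symm.toLinearMap =
      D.lact ∘ₗ LinearMap.lTensor P (thetaMap D) := by
  ext p q c
  simp [thetaMap_tmul, D.lact_action.2]

lemma lam_thetaMap :
    D.lam ∘ₗ thetaMap D =
      (LinearMap.lTensor P (thetaMap D)) ∘ₗ
        (TensorProduct.assoc k P P (leftCoinv D.lam)).toLinearMap ∘ₗ
        (LinearMap.rTensor (leftCoinv D.lam) (Coalgebra.comul (R := k) (A := P))) := by
  refine TensorProduct.ext' fun p c => ?_
  simp only [LinearMap.comp_apply, thetaMap_tmul, lam_lact_coinv, LinearMap.rTensor_tmul]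
  generalize Coalgebra.comul (R := k) p = u
  induction u with
  | zero => simp
  | add x y hx hy => simp only [TensorProduct.add_tmul, map_add, hx, hy]
  | tmul u u' => simp [thetaMap_tmul]

lemma ρ_thetaMap (ρC : (leftCoinv D.lam) →ₗ[k] (leftCoinv D.lam) ⊗[k] H)
    (hρC : (LinearMap.rTensor H (leftCoinv D.lam).subtype) ∘ₗ ρC =
      D.ρ ∘ₗ (leftCoinv D.lam).subtype) :
    D.ρ ∘ₗ thetaMap D =
      (LinearMap.rTensor H (thetaMap D)) ∘ₗ
        (LinearMap.lTensor (P ⊗[k] (leftCoinv D.lam)) (LinearMap.mul' k H)) ∘ₗ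
        (tensorTensorTensorComm k P H (leftCoinv D.lam) H).toLinearMap ∘ₗ
        (TensorProduct.map (piCoact π) ρC) := by
  refine TensorProduct.ext' fun p c => ?_
  have h1 := LinearMap.congr_fun D.lact_ρ (p ⊗ₜ (c : Y))
  have h2 : LinearMap.rTensor H (leftCoinv D.lam).subtype (ρC c) = D.ρ c :=
    LinearMap.congr_fun hρC c
  simp only [LinearMap.comp_apply, TensorProduct.map_tmul, thetaMap_tmul] at h1 ⊢
  rw [h1, ← h2]
  generalize piCoact π p = u
  generalize ρC c = w
  induction u with
  | zero => simp
  | add x y hx hy => simp only [TensorProduct.add_tmul, map_add, hx, hy]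
  | tmul q h =>
    induction w with
    | zero => simp
    | add x y hx hy => simp only [TensorProduct.tmul_add, map_add, hx, hy]
    | tmul d h' => simp [thetaMap_tmul]

lemma thetaMap_ract (hco : IsRestrictedComul π coactB)
    (actC : (leftCoinv D.lam) ⊗[k] (qhsAlg π) →ₗ[k] (leftCoinv D.lam))
    (hactC : ∀ (c : leftCoinv D.lam) (b : qhsAlg π),
      (actC (c ⊗ₜ b) : Y) = twistRact π coactB D.lact D.ract ((c : Y) ⊗ₜ b)) :
    thetaMap D ∘ₗ (TensorProduct.map (LinearMap.mul' k P) actC) ∘ₗ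
        (tensorTensorTensorComm k P (leftCoinv D.lam) P (qhsAlg π)).toLinearMap ∘ₗ
        (LinearMap.lTensor (P ⊗[k] (leftCoinv D.lam)) coactB) =
      D.ract ∘ₗ LinearMap.rTensor (qhsAlg π) (thetaMap D) := by
  refine TensorProduct.ext_threefold fun p c b => ?_
  let g : (qhsAlg π) →ₗ[k] Y := D.ract ∘ₗ TensorProduct.mk k Y _ (c : Y)
  have htwist : ∀ b', (actC (c ⊗ₜ b') : Y) =
      coactConv D.lact coactB (HopfAlgebra.antipode k) g b' := by
    intro b'
    rw [hactC]
    simp only [twistRact, coactConv, LinearMap.comp_apply, LinearMap.lTensor_tmul]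
    generalize coactB b' = w
    induction w with
    | zero => simp
    | add x y hx hy => simp only [TensorProduct.tmul_add, map_add, hx, hy]
    | tmul q d => simp [g]
  have hg := LinearMap.congr_fun (coactConv_id_antipode D.lact_action
    (isLeftCoaction_of_isRestrictedComul hco) g) b
  have h : ∀ w : P ⊗[k] (qhsAlg π),
      thetaMap D (TensorProduct.map (LinearMap.mul' k P) actC
        (tensorTensorTensorComm k P (leftCoinv D.lam) P (qhsAlg π) ((p ⊗ₜ c) ⊗ₜ w))) =
      D.lact (p ⊗ₜ D.lact (TensorProduct.map LinearMap.id
        (coactConv D.lact coactB (HopfAlgebra.antipode k) g) w)) := by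
    intro w
    induction w with
    | zero => simp
    | add x y hx hy => simp only [TensorProduct.tmul_add, map_add, hx, hy]
    | tmul q d => simp [thetaMap_tmul, htwist, D.lact_action.2]
  have hb := h (coactB b)
  rw [show D.lact (TensorProduct.map LinearMap.id
    (coactConv D.lact coactB (HopfAlgebra.antipode k) g) (coactB b)) = g b from hg] at hb
  simp only [LinearMap.comp_apply, LinearMap.lTensor_tmul, LinearMap.rTensor_tmul,
    LinearEquiv.coe_coe, thetaMap_tmul, D.acts_comm]
  exact hb

end PPHBStr

/-- For a `(P,P,H,B)`-Hopf module `Y`, the map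
`y ↦ y₍₋₁₎ ⊗ S(y₍₀₎₍₋₁₎) ▷ y₍₀₎₍₀₎` lands in `P ⊗ ᴾY` and is a bijection with
inverse `Θ : p ⊗ y ↦ p ▷ y`; moreover `Θ` is an isomorphism with respect to all
four (co)module structures, where `P ⊗ ᴾY` carries the regular left structures on
`P` and the tensor product right structures. -/
theorem pphb_structure_theorem (hπ : Function.Surjective π)
    (hco : IsRestrictedComul π coactB) (D : PPHBStr π coactB Y) :
    -- Ψ lands in P ⊗ ᴾY
    (∀ y : Y, psiMap D y ∈
      LinearMap.range (LinearMap.lTensor P (leftCoinv D.lam).subtype)) ∧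
    -- Θ is bijective
    Function.Bijective (thetaMap D) ∧
    -- Ψ is inverse to Θ
    (∀ z : P ⊗[k] (leftCoinv D.lam),
      psiMap D (thetaMap D z) = (LinearMap.lTensor P (leftCoinv D.lam).subtype) z) ∧
    -- Θ intertwines the left regular P-action
    (thetaMap D ∘ₗ (LinearMap.rTensor (leftCoinv D.lam) (LinearMap.mul' k P)) ∘ₗ
        (TensorProduct.assoc k P P (leftCoinv D.lam)).symm.toLinearMap =
      D.lact ∘ₗ LinearMap.lTensor P (thetaMap D)) ∧
    -- Θ intertwines the left regular P-coaction
    (D.lam ∘ₗ thetaMap D =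
      (LinearMap.lTensor P (thetaMap D)) ∘ₗ
        (TensorProduct.assoc k P P (leftCoinv D.lam)).toLinearMap ∘ₗ
        (LinearMap.rTensor (leftCoinv D.lam) (Coalgebra.comul (R := k) (A := P)))) ∧
    -- Θ intertwines the tensor product right H-coaction
    (∀ ρC : (leftCoinv D.lam) →ₗ[k] (leftCoinv D.lam) ⊗[k] H,
      (LinearMap.rTensor H (leftCoinv D.lam).subtype) ∘ₗ ρC =
          D.ρ ∘ₗ (leftCoinv D.lam).subtype →
      D.ρ ∘ₗ thetaMap D =
        (LinearMap.rTensor H (thetaMap D)) ∘ₗ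
          (LinearMap.lTensor (P ⊗[k] (leftCoinv D.lam)) (LinearMap.mul' k H)) ∘ₗ
          (tensorTensorTensorComm k P H (leftCoinv D.lam) H).toLinearMap ∘ₗ
          (TensorProduct.map (piCoact π) ρC)) ∧
    -- Θ intertwines the tensor product right B-action (with the twisted action on ᴾY)
    (∀ actC : (leftCoinv D.lam) ⊗[k] (qhsAlg π) →ₗ[k] (leftCoinv D.lam),
      (∀ (c : leftCoinv D.lam) (b : qhsAlg π),
        (actC (c ⊗ₜ b) : Y) = twistRact π coactB D.lact D.ract ((c : Y) ⊗ₜ b)) →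
      thetaMap D ∘ₗ (TensorProduct.map (LinearMap.mul' k P) actC) ∘ₗ
          (tensorTensorTensorComm k P (leftCoinv D.lam) P (qhsAlg π)).toLinearMap ∘ₗ
          (LinearMap.lTensor (P ⊗[k] (leftCoinv D.lam)) coactB) =
        D.ract ∘ₗ LinearMap.rTensor (qhsAlg π) (thetaMap D)) := by
  exact ⟨fun y => ⟨_, (D.psiMap_apply y).symm⟩, D.thetaMap_bijective, D.psiMap_thetaMap,
    D.thetaMap_mul, D.lam_thetaMap, D.ρ_thetaMap, D.thetaMap_ract hco⟩
end
end

section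
/- Let π: P → H be a surjective map of Hopf algebras over a field k and B := Pᴴ. Then B⁺ := ker(ε) ∩ B, with the right regular B-module structure x◁b := xb and the right H-comodule structure b ↦ b₂ ⊗ π(S(b₁)), is a crossed (H,B)-module; i.e. the coaction is well defined on B⁺ and the compatibility x₍₀₎b ⊗ x₍₁₎ = (xb₂)₍₀₎ ⊗ π(b₁)(xb₂)₍₁₎ holds for all x ∈ B⁺, b ∈ B. -/
open TensorProduct CategoryTheory

noncomputable section

variable {k : Type} [Field k]
variable {P : Type} [Ring P] [HopfAlgebra k P]
variable {H : Type} [Ring H] [HopfAlgebra k H]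

/-- `B⁺ = ker ε ∩ B` as a `k`-subspace of `P`. -/
def qhsPlus (π : P →ₐc[k] H) : Submodule k P :=
  Subalgebra.toSubmodule (qhsAlg π) ⊓
    LinearMap.ker (Coalgebra.counit (R := k) (A := P))

lemma mul_mem_qhsPlus (π : P →ₐc[k] H) (x : qhsPlus π) (b : qhsAlg π) :
    (x : P) * (b : P) ∈ qhsPlus π := by
  have hx := x.2
  simp only [qhsPlus, Submodule.mem_inf] at hx ⊢
  refine ⟨Subalgebra.mul_mem _ hx.1 b.2, ?_⟩
  rw [LinearMap.mem_ker]
  have h2 := map_mul (Bialgebra.counitAlgHom k P) (x : P) (b : P)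
  simp only [Bialgebra.counitAlgHom_apply] at h2
  rw [h2, LinearMap.mem_ker.mp hx.2, zero_mul]

/-- The right regular action of `B` on `B⁺`, `x ◁ b = xb`. -/
def ractPlus (π : P →ₐc[k] H) : (qhsPlus π) ⊗[k] (qhsAlg π) →ₗ[k] (qhsPlus π) :=
  TensorProduct.lift (LinearMap.mk₂ k
    (fun x b => (⟨(x : P) * (b : P), mul_mem_qhsPlus π x b⟩ : qhsPlus π))
    (fun x y b => Subtype.ext (by simp [add_mul]))
    (fun c x b => Subtype.ext (by simp [smul_mul_assoc]))
    (fun x b b' => Subtype.ext (by simp [mul_add]))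
    (fun c x b => Subtype.ext (by simp [mul_smul_comm])))

/-- The projection `B → B⁺`, `b ↦ b − ε(b)1`. -/
def toPlus (π : P →ₐc[k] H) : (qhsAlg π) →ₗ[k] (qhsPlus π) :=
  LinearMap.codRestrict (qhsPlus π)
    ((qhsIncl π) - (Algebra.linearMap k P) ∘ₗ
      (Coalgebra.counit (R := k) (A := P)) ∘ₗ (qhsIncl π))
    (fun b => by
      simp only [qhsPlus, Submodule.mem_inf]
      constructor
      · simp only [LinearMap.sub_apply, LinearMap.comp_apply]
        exact sub_mem b.2 ((qhsAlg π).algebraMap_mem _)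
      · rw [LinearMap.mem_ker]
        simp only [LinearMap.sub_apply, LinearMap.comp_apply, map_sub]
        have : Coalgebra.counit (R := k) (A := P)
            ((Algebra.linearMap k P) (Coalgebra.counit (R := k) (A := P) (qhsIncl π b)))
            = Coalgebra.counit (R := k) (A := P) (qhsIncl π b) := by
          simp [Algebra.linearMap_apply]
        rw [this, sub_self])

section Lemmas

open Coalgebra HopfAlgebra WithConv

section Antipode
variable {R C A : Type*} [CommSemiring R] [Semiring C] [HopfAlgebra R C] [Semiring A] [Algebra R A]

lemma toConv_algHom_antipode_mul_self (g : C →ₐ[R] A) :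
    toConv (g.toLinearMap ∘ₗ antipode R) * toConv g.toLinearMap = 1 := by
  have h := LinearMap.algHom_comp_convMul_distrib g (toConv (antipode R (A := C))) (toConv LinearMap.id)
  rw [LinearMap.antipode_mul_id] at h
  apply WithConv.ofConv_injective
  simp only [LinearMap.comp_id] at h
  rw [← h]
  ext c
  simp

/-- The antipode of a Hopf algebra reverses the comultiplication. -/
lemma comul_comp_antipode :
    comul ∘ₗ antipode R (A := C) =
      TensorProduct.map (antipode R) (antipode R) ∘ₗ
        (TensorProduct.comm R C C).toLinearMap ∘ₗ comul := by
  apply WithConv.toConv_injective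
  let i₁ : C →ₐ[R] C ⊗[R] C := Algebra.TensorProduct.includeLeft
  let i₂ : C →ₐ[R] C ⊗[R] C := Algebra.TensorProduct.includeRight
  have hδ : toConv (comul (R := R) (A := C)) = toConv i₁.toLinearMap * toConv i₂.toLinearMap := by
    ext c
    rw [(ℛ R c).convMul_apply]
    simp [i₁, i₂, (ℛ R c).eq]
  have hS : toConv (TensorProduct.map (antipode R) (antipode R) ∘ₗ
      (TensorProduct.comm R C C).toLinearMap ∘ₗ comul) =
      toConv (i₂.toLinearMap ∘ₗ antipode R) * toConv (i₁.toLinearMap ∘ₗ antipode R) := by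
    ext c
    rw [(ℛ R c).convMul_apply]
    simp [i₁, i₂, ← (ℛ R c).eq]
  symm
  apply left_inv_eq_right_inv (a := toConv (comul (R := R) (A := C)))
  · rw [hS, hδ, mul_assoc, ← mul_assoc (toConv (i₁.toLinearMap ∘ₗ _)),
      toConv_algHom_antipode_mul_self, one_mul, toConv_algHom_antipode_mul_self]
  · exact LinearMap.comul_right_inv

lemma comul_antipode_apply (c : C) :
    comul (antipode R c) =
      TensorProduct.map (antipode R) (antipode R) (TensorProduct.comm R C C (comul c)) :=
  LinearMap.congr_fun comul_comp_antipode c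

end Antipode

/-- The map `π ∘ S : P → H`. -/
def piAntipode (π : P →ₐc[k] H) : P →ₗ[k] H :=
  (π : P →ₗ[k] H) ∘ₗ antipode k

lemma adCoact₀_apply (π : P →ₐc[k] H) (p : P) :
    adCoact₀ π p = TensorProduct.comm k H P ((piAntipode π).rTensor P (comul p)) := by
  simp only [adCoact₀, LinearMap.comp_apply, LinearEquiv.coe_coe]
  generalize comul (R := k) p = z
  induction z with
  | zero => simp
  | tmul a b => simp [piAntipode]
  | add a b ha hb => simp only [map_add, ha, hb]

lemma counit_piAntipode (π : P →ₐc[k] H) (p : P) :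
    counit (R := k) (piAntipode π p) = counit (R := k) p := by
  simp [piAntipode]

lemma piAntipode_mul (π : P →ₐc[k] H) (p q : P) :
    piAntipode π (p * q) = piAntipode π q * piAntipode π p := by
  simp [piAntipode, antipode_mul_antidistrib]

lemma comul_piAntipode (π : P →ₐc[k] H) (p : P) :
    comul (R := k) (piAntipode π p) =
      TensorProduct.map (piAntipode π) (piAntipode π) (TensorProduct.comm k P P (comul p)) := by
  have h : comul (R := k) (π (antipode k p)) =
      TensorProduct.map (π : P →ₗ[k] H) (π : P →ₗ[k] H) (comul (antipode k p)) := by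
    exact (CoalgHomClass.map_comp_comul_apply π _).symm
  rw [piAntipode, TensorProduct.map_comp]
  exact h.trans (by rw [comul_antipode_apply]; rfl)

lemma piAntipode_of_mem_qhs (π : P →ₐc[k] H) {b : P} (hb : b ∈ qhs π) :
    piAntipode π b = algebraMap k H (counit b) := by
  have h := congrArg (LinearMap.mul' k H ∘ₗ (piAntipode π).rTensor H) ((mem_qhs π b).1 hb)
  have h' : (LinearMap.mul' k H ∘ₗ (piAntipode π).rTensor H)
      ((LinearMap.lTensor P (π : P →ₗ[k] H)) (comul b)) =
      π (LinearMap.mul' k P ((antipode k).rTensor P (comul b))) := by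
    generalize comul (R := k) b = z
    induction z with
    | zero => simp
    | tmul a b => simp [piAntipode]
    | add a b ha hb => simp only [map_add, ha, hb]
  rw [h', mul_antipode_rTensor_comul_apply, AlgHomClass.commutes] at h
  simpa using h.symm

lemma rTensor_counit_adCoact₀ (π : P →ₐc[k] H) (p : P) :
    (counit (R := k) (A := P)).rTensor H (adCoact₀ π p) = 1 ⊗ₜ piAntipode π p := by
  have h : (counit (R := k) (A := P)).rTensor H (adCoact₀ π p) =
      TensorProduct.comm k H k ((piAntipode π).rTensor k (counit.lTensor P (comul p))) := by
    rw [adCoact₀_apply]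
    generalize comul (R := k) p = z
    induction z with
    | zero => simp
    | tmul a b => simp
    | add a b ha hb => simp only [map_add, ha, hb]
  rw [h, lTensor_counit_comul]
  simp

lemma rTensor_piCoact_adCoact₀ (π : P →ₐc[k] H) {b : P} (hb : b ∈ qhs π) :
    (piCoact π).rTensor H (adCoact₀ π b) =
      ((TensorProduct.mk k P H).flip 1).rTensor H (adCoact₀ π b) := by
  let T : P ⊗[k] (P ⊗[k] P) →ₗ[k] (P ⊗[k] H) ⊗[k] H :=
    (TensorProduct.comm k H (P ⊗[k] H)).toLinearMap ∘ₗ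
      TensorProduct.map (piAntipode π) ((π : P →ₗ[k] H).lTensor P)
  let U : P ⊗[k] H →ₗ[k] (P ⊗[k] H) ⊗[k] H :=
    (TensorProduct.comm k H (P ⊗[k] H)).toLinearMap ∘ₗ (piAntipode π).rTensor (P ⊗[k] H) ∘ₗ
      (TensorProduct.assoc k P P H).toLinearMap ∘ₗ comul.rTensor H
  have h₁ : (piCoact π).rTensor H (adCoact₀ π b) = T (comul.lTensor P (comul b)) := by
    rw [adCoact₀_apply]
    generalize comul (R := k) b = z
    induction z with
    | zero => simp
    | tmul a b => simp [T, piCoact]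
    | add a b ha hb => simp only [map_add, ha, hb]
  have h₂ : T (TensorProduct.assoc k P P P (comul.rTensor P (comul b))) =
      U ((π : P →ₗ[k] H).lTensor P (comul b)) := by
    generalize comul (R := k) b = z
    induction z with
    | zero => simp
    | tmul a b =>
      simp only [LinearMap.rTensor_tmul, LinearMap.lTensor_tmul, U, LinearMap.comp_apply]
      generalize comul (R := k) a = y
      induction y with
      | zero => simp
      | tmul c d => simp [T]
      | add c d hc hd => simp only [map_add, TensorProduct.add_tmul, hc, hd]
    | add a b ha hb => simp only [map_add, ha, hb]
  rw [h₁, ← coassoc_apply, h₂, (mem_qhs π b).1 hb, adCoact₀_apply]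
  simp only [U, LinearMap.comp_apply, LinearMap.rTensor_tmul]
  generalize comul (R := k) b = z
  induction z with
  | zero => simp
  | tmul a b => simp
  | add a b ha hb => simp only [map_add, TensorProduct.add_tmul, ha, hb]

lemma adCoact₀_mem_range (π : P →ₐc[k] H) {x : P} (hx : x ∈ qhsPlus π) :
    adCoact₀ π x ∈ LinearMap.range ((qhsPlus π).subtype.rTensor H) := by
  let Φ : P →ₗ[k] (P ⊗[k] H) × k :=
    LinearMap.inl k _ _ ∘ₗ (piCoact π - (TensorProduct.mk k P H).flip 1) +
      LinearMap.inr k _ _ ∘ₗ counit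
  have hmem (p : P) : p ∈ qhsPlus π ↔ p ∈ qhs π ∧ counit (R := k) p = 0 := Iff.rfl
  have hΦ : Function.Exact (qhsPlus π).subtype Φ := by
    intro p
    have : p ∈ Set.range (qhsPlus π).subtype ↔ p ∈ qhsPlus π := by simp
    rw [this, hmem, mem_qhs]
    simp [Φ, piCoact, sub_eq_zero]
  refine (Module.Flat.rTensor_exact H hΦ _).1 ?_
  obtain ⟨hxB, hxε⟩ := (hmem x).1 hx
  simp only [Φ, LinearMap.rTensor_add, LinearMap.rTensor_comp, LinearMap.rTensor_sub,
    LinearMap.add_apply, LinearMap.comp_apply, LinearMap.sub_apply,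
    rTensor_piCoact_adCoact₀ π hxB, rTensor_counit_adCoact₀, piAntipode_of_mem_qhs π hxB, hxε]
  simp

/-- The map `a ↦ a₂ ⊗ π(S(a₁))` is a right `H`-coaction on `P`. -/
lemma isRightCoaction_adCoact₀ (π : P →ₐc[k] H) : IsRightCoaction (adCoact₀ π) := by
  refine ⟨fun p => ?_, fun p => ?_⟩
  · have h : TensorProduct.rid k P (counit.lTensor P (adCoact₀ π p)) =
        TensorProduct.lid k P (counit.rTensor P (comul p)) := by
      rw [adCoact₀_apply]
      generalize comul (R := k) p = z
      induction z with
      | zero => simp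
      | tmul a b => simp [counit_piAntipode]
      | add a b ha hb => simp only [map_add, ha, hb]
    rw [h, rTensor_counit_comul, TensorProduct.lid_tmul, one_smul]
  · let T : P ⊗[k] (P ⊗[k] P) →ₗ[k] (P ⊗[k] H) ⊗[k] H :=
      (TensorProduct.comm k H (P ⊗[k] H)).toLinearMap ∘ₗ
        TensorProduct.map (piAntipode π)
          ((TensorProduct.comm k H P).toLinearMap ∘ₗ (piAntipode π).rTensor P)
    have h₁ : (adCoact₀ π).rTensor H (adCoact₀ π p) = T (comul.lTensor P (comul p)) := by
      rw [adCoact₀_apply]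
      generalize comul (R := k) p = z
      induction z with
      | zero => simp
      | tmul a b => simp [T, adCoact₀_apply]
      | add a b ha hb => simp only [map_add, ha, hb]
    rw [h₁, ← coassoc_apply, adCoact₀_apply]
    generalize comul (R := k) p = z
    induction z with
    | zero => simp
    | tmul a b =>
      simp only [LinearMap.rTensor_tmul, LinearMap.lTensor_tmul, TensorProduct.comm_tmul,
        comul_piAntipode]
      generalize comul (R := k) a = y
      induction y with
      | zero => simp
      | tmul c d => simp [T]
      | add c d hc hd => simp only [map_add, TensorProduct.add_tmul, TensorProduct.tmul_add, hc, hd]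
    | add a b ha hb => simp only [map_add, ha, hb]

/-- A subspace stable under a coaction inherits it. -/
lemma IsRightCoaction.of_injective {V W : Type} [AddCommGroup V] [Module k V] [AddCommGroup W]
    [Module k W] {ρ : V →ₗ[k] V ⊗[k] H} {σ : W →ₗ[k] W ⊗[k] H} (hσ : IsRightCoaction σ)
    {ι : V →ₗ[k] W} (hι : Function.Injective ι) (h : ι.rTensor H ∘ₗ ρ = σ ∘ₗ ι) :
    IsRightCoaction ρ := by
  have hv (v : V) : ι.rTensor H (ρ v) = σ (ι v) := LinearMap.congr_fun h v
  refine ⟨fun v => hι ?_, fun v => ?_⟩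
  · rw [← hσ.1 (ι v), ← hv]
    generalize ρ v = z
    induction z with
    | zero => simp
    | tmul a b => simp
    | add a b ha hb => simp only [map_add, ha, hb]
  · apply Module.Flat.rTensor_preserves_injective_linearMap (M := H) _
      (Module.Flat.rTensor_preserves_injective_linearMap (M := H) _ hι)
    have h₁ : (ι.rTensor H).rTensor H (ρ.rTensor H (ρ v)) = σ.rTensor H (σ (ι v)) := by
      rw [← hv, ← LinearMap.comp_apply, ← LinearMap.rTensor_comp, h, LinearMap.rTensor_comp,
        LinearMap.comp_apply]
    rw [h₁, hσ.2, ← hv]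
    generalize ρ v = z
    induction z with
    | zero => simp
    | tmul a b =>
      simp only [LinearMap.rTensor_tmul, LinearMap.lTensor_tmul]
      generalize comul (R := k) b = y
      induction y with
      | zero => simp
      | tmul c d => simp
      | add c d hc hd => simp only [map_add, TensorProduct.tmul_add, hc, hd]
    | add a b ha hb => simp only [map_add, ha, hb]

/-- The map `p ⊗ q ↦ (xq)₂ ⊗ π(p)π(S((xq)₁))`. -/
def mulAdCoact (π : P →ₐc[k] H) (x : P) : P ⊗[k] P →ₗ[k] P ⊗[k] H :=
  TensorProduct.lift (((LinearMap.lTensorHom P ∘ₗ LinearMap.mul k H ∘ₗ (π : P →ₗ[k] H)).compl₂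
    (adCoact₀ π ∘ₗ LinearMap.mulLeft k x)))

lemma mulAdCoact_tmul (π : P →ₐc[k] H) (x p q : P) :
    mulAdCoact π x (p ⊗ₜ q) = (LinearMap.mulLeft k (π p)).lTensor P (adCoact₀ π (x * q)) := rfl

lemma mulAdCoact_comul (π : P →ₐc[k] H) (x b : P) :
    mulAdCoact π x (comul b) = (LinearMap.mulRight k b).rTensor H (adCoact₀ π x) := by
  let K : P ⊗[k] (P ⊗[k] P) →ₗ[k] P ⊗[k] H :=
    (TensorProduct.comm k H P).toLinearMap ∘ₗ
      (LinearMap.mul' k H ∘ₗ TensorProduct.map (π : P →ₗ[k] H) (piAntipode π)).rTensor P ∘ₗ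
      (TensorProduct.assoc k P P P).symm.toLinearMap
  let V : P ⊗[k] P →ₗ[k] P ⊗[k] H →ₗ[k] P ⊗[k] H :=
    TensorProduct.lift ((TensorProduct.mapBilinear (.id k) P H P H).flip.compl₁₂
      ((LinearMap.mul k H).flip ∘ₗ piAntipode π) (LinearMap.mul k P))
  have hV (u v c : P) (h : H) : V (u ⊗ₜ v) (c ⊗ₜ h) = (v * c) ⊗ₜ (h * piAntipode π u) := rfl
  have hVK (p q : P) : mulAdCoact π x (p ⊗ₜ q) = V (comul x) (K (p ⊗ₜ comul q)) := by
    rw [mulAdCoact_tmul, adCoact₀_apply, Bialgebra.comul_mul]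
    generalize comul (R := k) x = y
    generalize comul (R := k) q = z
    induction y with
    | zero => simp
    | tmul u v =>
      induction z with
      | zero => simp
      | tmul a b => simp [K, hV, piAntipode_mul, mul_assoc]
      | add a b ha hb => simp only [map_add, mul_add, TensorProduct.tmul_add, ha, hb]
    | add a b ha hb => simp only [map_add, add_mul, LinearMap.add_apply, ha, hb]
  have hVK' (z : P ⊗[k] P) : mulAdCoact π x z = V (comul x) (K (comul.lTensor P z)) := by
    induction z with
    | zero => simp
    | tmul p q => exact hVK p q
    | add a b ha hb => simp only [map_add, ha, hb]
  have hK : K (TensorProduct.assoc k P P P (comul.rTensor P (comul b))) =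
      TensorProduct.comm k H P ((Algebra.linearMap k H).rTensor P
        ((counit (R := k) (A := P)).rTensor P (comul b))) := by
    generalize comul (R := k) b = z
    induction z with
    | zero => simp
    | tmul a c =>
      have ha : (LinearMap.mul' k H) (TensorProduct.map (π : P →ₗ[k] H) (piAntipode π) (comul a)) =
          algebraMap k H (counit a) := by
        have h : (LinearMap.mul' k H)
            (TensorProduct.map (π : P →ₗ[k] H) (piAntipode π) (comul a)) =
            π (LinearMap.mul' k P ((antipode k).lTensor P (comul a))) := by
          generalize comul (R := k) a = y
          induction y with
          | zero => simp
          | tmul c d => simp [piAntipode]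
          | add c d hc hd => simp only [map_add, hc, hd]
        rw [h, mul_antipode_lTensor_comul_apply, AlgHomClass.commutes]
      simp [K, ha]
    | add a b ha hb => simp only [map_add, ha, hb]
  rw [hVK', ← coassoc_apply, hK, rTensor_counit_comul, adCoact₀_apply]
  generalize comul (R := k) x = y
  induction y with
  | zero => simp
  | tmul u v => simp [hV]
  | add a b ha hb => simp only [map_add, LinearMap.add_apply, ha, hb]

/-- The coaction of `B⁺` is compatible with right multiplication by `B`. -/
lemma isCrossedPair_ractPlus (π : P →ₐc[k] H) {ρ : qhsPlus π →ₗ[k] qhsPlus π ⊗[k] H}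
    (hρ : (qhsPlus π).subtype.rTensor H ∘ₗ ρ = adCoact₀ π ∘ₗ (qhsPlus π).subtype)
    {coactB : qhsAlg π →ₗ[k] P ⊗[k] qhsAlg π} (hB : IsRestrictedComul π coactB) :
    IsCrossedPair π coactB (ractPlus π) ρ := by
  have hρ' (v : qhsPlus π) : (qhsPlus π).subtype.rTensor H (ρ v) = adCoact₀ π v :=
    LinearMap.congr_fun hρ v
  have hB' (b : qhsAlg π) : (qhsIncl π).lTensor P (coactB b) = comul (b : P) :=
    LinearMap.congr_fun hB b
  have hract (x : qhsPlus π) (b : qhsAlg π) : (ractPlus π (x ⊗ₜ b) : P) = x * b := rfl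
  refine TensorProduct.ext' fun x b =>
    Module.Flat.rTensor_preserves_injective_linearMap (M := H) (qhsPlus π).subtype
      (qhsPlus π).injective_subtype ?_
  trans mulAdCoact π x (comul (b : P))
  · rw [mulAdCoact_comul, ← hρ']
    simp only [LinearMap.comp_apply, LinearMap.rTensor_tmul]
    generalize ρ x = z
    induction z with
    | zero => simp
    | tmul a c => simp [hract]
    | add a c ha hc => simp only [map_add, TensorProduct.add_tmul, ha, hc]
  · rw [← hB']
    simp only [LinearMap.comp_apply, LinearMap.lTensor_tmul]
    generalize coactB b = z
    induction z with
    | zero => simp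
    | tmul p c =>
      have hc : adCoact₀ π (x * c) = (qhsPlus π).subtype.rTensor H (ρ (ractPlus π (x ⊗ₜ c))) := by
        rw [hρ', hract]
      simp only [LinearMap.lTensor_tmul, LinearEquiv.coe_coe, TensorProduct.leftComm_tmul,
        TensorProduct.map_tmul, LinearMap.comp_apply]
      refine (mulAdCoact_tmul π x p c).trans ?_
      rw [hc]
      generalize ρ _ = w
      induction w with
      | zero => simp
      | tmul a d => simp
      | add a d ha hd => simp only [map_add, TensorProduct.tmul_add, ha, hd]
    | add a c ha hc => simp only [map_add, TensorProduct.tmul_add, ha, hc]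

end Lemmas

/-- `B⁺ = ker ε ∩ B`, with the right regular `B`-action `x ◁ b = xb`
and the right `H`-coaction `b ↦ b₂ ⊗ π(S(b₁))`, is a crossed `(H,B)`-module: the
coaction is well defined on `B⁺` and the crossed module compatibility holds. -/
theorem bplus_crossed_module (π : P →ₐc[k] H) (hπ : Function.Surjective π) :
    -- the coaction b ↦ b₂ ⊗ π(S(b₁)) restricts to B⁺
    (∀ x ∈ qhsPlus π, adCoact₀ π x ∈
      LinearMap.range (LinearMap.rTensor H (qhsPlus π).subtype)) ∧
    -- the right regular action is a right B-module structure on B⁺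
    IsRightAction (ractPlus π) ∧
    -- together they form a crossed (H,B)-module
    (∀ ρBp : (qhsPlus π) →ₗ[k] (qhsPlus π) ⊗[k] H,
      (LinearMap.rTensor H (qhsPlus π).subtype) ∘ₗ ρBp =
          adCoact₀ π ∘ₗ (qhsPlus π).subtype →
      IsRightCoaction ρBp ∧
      (∀ coactB : (qhsAlg π) →ₗ[k] P ⊗[k] (qhsAlg π),
        IsRestrictedComul π coactB → IsCrossedPair π coactB (ractPlus π) ρBp)) := by
  refine ⟨fun x hx => adCoact₀_mem_range π hx, ⟨fun v => ?_, fun v a b => ?_⟩, fun ρ hρ =>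
    ⟨(isRightCoaction_adCoact₀ π).of_injective (qhsPlus π).injective_subtype hρ,
      fun _ hB => isCrossedPair_ractPlus π hρ hB⟩⟩
  · exact Subtype.ext (by simp [ractPlus])
  · exact Subtype.ext (by simp [ractPlus, mul_assoc])
end
end
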